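/- Let X be an infinite transitive subshift on an alphabet of size a with SFT cover {X_n}. If X_n ⊋ X_{n+k−1} for some n, k, then h_top(X_n) − h_top(X_{n+k−1}) > (ln 2) s^{−1} e^{−3(3s+4k) ln a}, where s = |L_n(X_n)| is the number of admissible words of length n. -/

import Mathlib

open Filter Topology MeasureTheory Set

def shiftMap (A : Type*) : (ℤ → A) → (ℤ → A) := fun x n => x (n + 1)

def occursAt {A : Type*} (x : ℤ → A) (i : ℤ) (w : List A) : Prop :=
  ∀ j : Fin w.length, x (i + (j : ℕ)) = w.get j

def inLang {A : Type*} (X : Set (ℤ → A)) (w : List A) : Prop :=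
  ∃ x ∈ X, occursAt x 0 w

def sftCover {A : Type*} (X : Set (ℤ → A)) (n : ℕ) : Set (ℤ → A) :=
  { x | ∀ (i : ℤ) (w : List A), w.length ≤ n → occursAt x i w → inLang X w }

def IsSubshift {A : Type*} [TopologicalSpace A] (X : Set (ℤ → A)) : Prop :=
  X.Nonempty ∧ IsClosed X ∧ shiftMap A '' X = X

def minPeriodPts {A : Type*} (S : Set (ℤ → A)) (p : ℕ) : Set (ℤ → A) :=
  { x ∈ S | (shiftMap A)^[p] x = x ∧ ∀ q : ℕ, 0 < q → q < p → (shiftMap A)^[q] x ≠ x }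

def PeriodStable {A : Type*} (X : Set (ℤ → A)) : Prop :=
  ∀ m : ℕ, ∃ n p : ℕ, 0 < p ∧
    minPeriodPts (sftCover X n) p = minPeriodPts (sftCover X (n + m)) p

def LanguageStable {A : Type*} (X : Set (ℤ → A)) : Prop :=
  ∀ m : ℕ, ∃ n : ℕ, sftCover X n = sftCover X (n + m)

def TopMixing {A : Type*} (X : Set (ℤ → A)) : Prop :=
  ∀ u v : List A, inLang X u → inLang X v →
    ∃ N : ℕ, ∀ n ≥ N, ∃ w : List A, w.length = n ∧ inLang X (u ++ w ++ v)

def LangTransitive {A : Type*} (X : Set (ℤ → A)) : Prop :=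
  ∀ u v : List A, inLang X u → inLang X v → ∃ w : List A, inLang X (u ++ w ++ v)

def globalSlide {A : Type*} (R : ℕ) (Φ : List A → A) : (ℤ → A) → (ℤ → A) :=
  fun x i => Φ (List.ofFn (fun j : Fin (2 * R + 1) => x (i - R + (j : ℕ))))

def wordSlide {A : Type*} (R : ℕ) (Φ : List A → A) (w : List A) : List A :=
  (List.range (w.length - 2 * R)).map (fun j => Φ ((w.drop j).take (2 * R + 1)))

noncomputable def subshiftEntropy {A : Type*} (X : Set (ℤ → A)) : ℝ :=
  Filter.limsup
    (fun n : ℕ => Real.log (Nat.card { w : List A // w.length = n ∧ inLang X w }) / n)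
    Filter.atTop

def IsNNSFT {A : Type*} (X : Set (ℤ → A)) : Prop :=
  ∃ F : Set (List A), (∀ w ∈ F, w.length ≤ 2) ∧
    X = { x | ∀ (i : ℤ) (w : List A), w ∈ F → ¬ occursAt x i w }

noncomputable def xi (s : ℕ) : ℝ :=
  30 * (s : ℝ) ^ (3 * (s ^ 2 + 1)) /
    (1 - Real.rpow (1 - 1 / (4 * (s : ℝ) ^ (2 * s ^ 2))) (1 / (s ^ 2 : ℝ)))

noncomputable def measEntropy {A : Type*} [Fintype A] [MeasurableSpace A]
    (μ : MeasureTheory.Measure (ℤ → A)) : ℝ :=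
  Filter.limsup
    (fun n : ℕ =>
      (∑ w : Fin n → A,
        Real.negMulLog ((μ { x : ℤ → A | ∀ j : Fin n, x ((j : ℕ) : ℤ) = w j }).toReal)) / n)
    Filter.atTop

/-- The transfer operator summing a function on words over all one-letter right extensions. -/
def extendSum {A : Type*} [Fintype A] (φ : List A → ℝ) : List A → ℝ :=
  fun v => ∑ c : A, φ (v ++ [c])

section ExtendSum

variable {A : Type*} [Fintype A]

theorem extendSum_iterate_succ (φ : List A → ℝ) (m : ℕ) (v : List A) :
    extendSum^[m + 1] φ v = ∑ c : A, extendSum^[m] φ (v ++ [c]) := by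
  rw [Function.iterate_succ_apply']; rfl

theorem extendSum_iterate_mono_at {φ ψ : List A → ℝ} (m : ℕ) {v v' : List A}
    (h : ∀ u : List A, u.length = m → φ (v ++ u) ≤ ψ (v' ++ u)) :
    extendSum^[m] φ v ≤ extendSum^[m] ψ v' := by
  induction m generalizing v v' with
  | zero => simpa using h [] rfl
  | succ m ih =>
    rw [extendSum_iterate_succ, extendSum_iterate_succ]
    refine Finset.sum_le_sum fun c _ => ih fun u hu => ?_
    simpa using h (c :: u) (by simp [hu])

theorem extendSum_iterate_zero (m : ℕ) (v : List A) :
    extendSum^[m] (fun _ => 0) v = 0 := by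
  induction m generalizing v with
  | zero => rfl
  | succ m ih => rw [extendSum_iterate_succ]; simp [ih]

theorem extendSum_iterate_nonneg {φ : List A → ℝ} (h : ∀ v, 0 ≤ φ v) (m : ℕ) (v : List A) :
    0 ≤ extendSum^[m] φ v := by
  rw [← extendSum_iterate_zero m v]
  exact extendSum_iterate_mono_at m fun u _ => h _

theorem le_extendSum_iterate {φ : List A → ℝ} (h : ∀ v, 0 ≤ φ v) (v u : List A) :
    φ (v ++ u) ≤ extendSum^[u.length] φ v := by
  induction u generalizing v with
  | nil => simp
  | cons c u ih =>
    rw [List.length_cons, extendSum_iterate_succ]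
    refine le_trans ?_ (Finset.single_le_sum
      (f := fun c => extendSum^[u.length] φ (v ++ [c]))
      (fun c _ => extendSum_iterate_nonneg h _ _) (Finset.mem_univ c))
    simpa using ih (v ++ [c])

theorem extendSum_iterate_sub (φ ψ : List A → ℝ) (m : ℕ) (v : List A) :
    extendSum^[m] (fun u => φ u - ψ u) v = extendSum^[m] φ v - extendSum^[m] ψ v := by
  induction m generalizing v with
  | zero => rfl
  | succ m ih => simp [extendSum_iterate_succ, ih]

theorem extendSum_iterate_const_mul (a : ℝ) (φ : List A → ℝ) (m : ℕ) (v : List A) :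
    extendSum^[m] (fun u => a * φ u) v = a * extendSum^[m] φ v := by
  induction m generalizing v with
  | zero => rfl
  | succ m ih => simp [extendSum_iterate_succ, ih, Finset.mul_sum]

theorem extendSum_iterate_le_pow {φ : List A → ℝ} {μ : ℝ} (hμ : 0 ≤ μ)
    (h : ∀ v, extendSum φ v ≤ μ * φ v) (m : ℕ) (v : List A) :
    extendSum^[m] φ v ≤ μ ^ m * φ v := by
  induction m generalizing v with
  | zero => simp
  | succ m ih =>
    rw [extendSum_iterate_succ]
    calc _ ≤ ∑ c : A, μ ^ m * φ (v ++ [c]) := Finset.sum_le_sum fun c _ => ih _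
      _ = μ ^ m * extendSum φ v := by rw [← Finset.mul_sum]; rfl
      _ ≤ μ ^ m * (μ * φ v) := by gcongr; exact h v
      _ = _ := by ring

open Classical in
theorem card_extensions_eq (P : List A → Prop) (m : ℕ) (v : List A) :
    (Nat.card {u : List A // u.length = m ∧ P (v ++ u)} : ℝ) =
      extendSum^[m] (fun u => if P u then 1 else 0) v := by
  induction m generalizing v with
  | zero =>
    by_cases hP : P v
    · have : Unique {u : List A // u.length = 0 ∧ P (v ++ u)} :=
        { default := ⟨[], by simpa using hP⟩
          uniq := fun u => Subtype.ext (List.length_eq_zero_iff.1 u.2.1) }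
      rw [Nat.card_unique]
      simp [hP]
    · have : IsEmpty {u : List A // u.length = 0 ∧ P (v ++ u)} :=
        ⟨fun u => hP (by
          have := u.2.2
          rw [List.length_eq_zero_iff.1 u.2.1] at this
          simpa using this)⟩
      rw [Nat.card_of_isEmpty]
      simp [hP]
  | succ m ih =>
    have e : {u : List A // u.length = m + 1 ∧ P (v ++ u)} ≃
        Σ c : A, {u : List A // u.length = m ∧ P (v ++ [c] ++ u)} :=
      { toFun := fun u => match u with
          | ⟨c :: u, h⟩ => ⟨c, u, by simpa using h⟩
          | ⟨[], h⟩ => absurd h.1 (by simp)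
        invFun := fun u => ⟨u.1 :: u.2.1, by have := u.2.2; simpa using this⟩
        left_inv := fun u => match u with
          | ⟨c :: u, h⟩ => rfl
          | ⟨[], h⟩ => absurd h.1 (by simp)
        right_inv := fun u => rfl }
    have hfin : ∀ c : A, Finite {u : List A // u.length = m ∧ P (v ++ [c] ++ u)} := fun c =>
      ((List.finite_length_eq A m).subset fun u hu => hu.1 :
        {u : List A | u.length = m ∧ P (v ++ [c] ++ u)}.Finite)
    rw [Nat.card_congr e, Nat.card_sigma, extendSum_iterate_succ]
    push_cast
    exact Finset.sum_congr rfl fun c _ => ih _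

end ExtendSum

section Language

variable {A : Type*} {X : Set (ℤ → A)} {n : ℕ}

theorem occursAt_append {x : ℤ → A} {i : ℤ} {u v : List A} :
    occursAt x i (u ++ v) ↔ occursAt x i u ∧ occursAt x (i + u.length) v := by
  constructor
  · intro h
    refine ⟨fun j => ?_, fun j => ?_⟩
    · simpa [List.getElem_append_left j.2] using h ⟨j, by simp; omega⟩
    · simpa [add_assoc] using h ⟨u.length + j, by simp⟩
  · rintro ⟨hu, hv⟩ ⟨j, hj⟩
    by_cases hju : j < u.length
    · simpa [List.getElem_append_left hju] using hu ⟨j, hju⟩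
    · have hj' : j < u.length + v.length := by simpa using hj
      have := hv ⟨j - u.length, by omega⟩
      simp only [List.get_eq_getElem] at this
      rw [List.get_eq_getElem, List.getElem_append_right (Nat.le_of_not_lt hju), ← this]
      congr 1
      push_cast [Nat.le_of_not_lt hju]
      ring

theorem occursAt_congr {x y : ℤ → A} {i j : ℤ} {u : List A}
    (h : ∀ m : ℕ, m < u.length → x (i + m) = y (j + m)) :
    occursAt x i u ↔ occursAt y j u := by
  refine forall_congr' fun m => ?_
  rw [h m m.2]

theorem occursAt_translate {x : ℤ → A} {i j : ℤ} {u : List A} :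
    occursAt (fun m => x (m + i)) j u ↔ occursAt x (j + i) u :=
  occursAt_congr fun m _ => congrArg x (by ring)

theorem translate_mem_sftCover {x : ℤ → A} (hx : x ∈ sftCover X n) (i : ℤ) :
    (fun m => x (m + i)) ∈ sftCover X n :=
  fun j w hw hocc => hx (j + i) w hw (occursAt_translate.1 hocc)

theorem inLang_sftCover_iff {w : List A} :
    inLang (sftCover X n) w ↔ ∃ x ∈ sftCover X n, ∃ i, occursAt x i w := by
  constructor
  · rintro ⟨x, hx, h⟩
    exact ⟨x, hx, 0, h⟩
  · rintro ⟨x, hx, i, h⟩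
    exact ⟨_, translate_mem_sftCover hx i, occursAt_translate.2 (by simpa using h)⟩

theorem inLang_sftCover_of_infix {u w : List A} (h : inLang (sftCover X n) w)
    (huw : u <:+: w) : inLang (sftCover X n) u := by
  obtain ⟨s, t, rfl⟩ := huw
  obtain ⟨x, hx, hocc⟩ := h
  rw [occursAt_append, occursAt_append] at hocc
  exact inLang_sftCover_iff.2 ⟨x, hx, _, hocc.1.2⟩

theorem inLang_of_inLang_sftCover {w : List A} (h : inLang (sftCover X n) w)
    (hw : w.length ≤ n) : inLang X w := by
  obtain ⟨x, hx, hocc⟩ := h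
  exact hx 0 w hw hocc

/-- Two admissible words overlapping in at least `n` letters can be glued along the overlap. -/
theorem inLang_sftCover_glue {p e q : List A} (he : e.length = n)
    (hp : inLang (sftCover X n) (p ++ e)) (hq : inLang (sftCover X n) (e ++ q)) :
    inLang (sftCover X n) (p ++ e ++ q) := by
  obtain ⟨x, hx, hxo⟩ := hp
  obtain ⟨y, hy, hyo⟩ := hq
  rw [occursAt_append] at hxo hyo
  have agree : ∀ m : ℕ, m < n → x (p.length + m) = y m := by
    intro m hm
    have h1 := hxo.2 ⟨m, he ▸ hm⟩
    have h2 := hyo.1 ⟨m, he ▸ hm⟩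
    simp only [zero_add] at h1 h2
    rw [h1, h2]
  let z : ℤ → A := fun i => if i < p.length + n then x i else y (i - p.length)
  have zx : ∀ i : ℤ, i < p.length + n → z i = x i := fun i hi => if_pos hi
  have zy : ∀ i : ℤ, p.length ≤ i → z i = y (i - p.length) := by
    intro i hi
    by_cases h : i < p.length + n
    · rw [zx i h]
      obtain ⟨m, hm⟩ := Int.eq_ofNat_of_zero_le (sub_nonneg.2 hi)
      have := agree m (by omega)
      rw [hm, ← this]
      congr 1
      omega
    · exact if_neg h
  refine ⟨z, fun i w hw hocc => ?_, ?_⟩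
  · by_cases h : i + w.length ≤ p.length + n
    · exact hx i w hw ((occursAt_congr fun m hm => (zx _ (by omega))).1 hocc)
    · refine hy (i - p.length) w hw ((occursAt_congr fun m hm => ?_).1 hocc)
      rw [zy _ (by omega)]
      congr 1
      ring
  · rw [occursAt_append, occursAt_append]
    refine ⟨⟨(occursAt_congr fun m hm => zx _ (by omega)).2 hxo.1,
      (occursAt_congr fun m hm => zx _ (by omega)).2 hxo.2⟩,
      (occursAt_congr fun m hm => ?_).2 hyo.2⟩
    rw [zy _ (by simp; omega)]
    congr 1
    simp
    ring

theorem exists_inLang_sftCover_append {w : List A} (h : inLang (sftCover X n) w) (m : ℕ) :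
    ∃ u : List A, u.length = m ∧ inLang (sftCover X n) (w ++ u) := by
  obtain ⟨x, hx, hocc⟩ := h
  refine ⟨List.ofFn fun j : Fin m => x (w.length + j), by simp, x, hx, ?_⟩
  rw [occursAt_append]
  exact ⟨hocc, fun j => by simp⟩

end Language

section Cover

variable {A : Type*} [TopologicalSpace A] {X : Set (ℤ → A)}

theorem IsSubshift.translate_mem (hX : IsSubshift X) {x : ℤ → A} (hx : x ∈ X) (i : ℤ) :
    (fun m => x (m + i)) ∈ X := by
  induction i using Int.induction_on with
  | zero => simpa using hx
  | succ i ih =>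
    rw [← hX.2.2]
    exact ⟨_, ih, funext fun m => by simp only [shiftMap]; congr 1; ring⟩
  | pred i ih =>
    rw [← hX.2.2] at ih
    obtain ⟨y, hy, hyx⟩ := ih
    convert hy using 1
    funext m
    have := congrFun hyx (m - 1)
    simp only [shiftMap, sub_add_cancel] at this
    rw [this]
    congr 1
    ring

theorem IsSubshift.subset_sftCover (hX : IsSubshift X) (n : ℕ) : X ⊆ sftCover X n :=
  fun _ hx i _ _ hocc =>
    ⟨_, hX.translate_mem hx i, occursAt_translate.2 (by simpa using hocc)⟩

theorem IsSubshift.inLang_sftCover (hX : IsSubshift X) {n : ℕ} {w : List A} (h : inLang X w) :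
    inLang (sftCover X n) w :=
  let ⟨x, hx, hocc⟩ := h
  ⟨x, hX.subset_sftCover n hx, hocc⟩

end Cover

theorem finite_length_and {A : Type*} [Finite A] (P : List A → Prop) (m : ℕ) :
    Finite {w : List A // w.length = m ∧ P w} :=
  ((List.finite_length_eq A m).subset fun _ hw => hw.1 :
    {w : List A | w.length = m ∧ P w}.Finite)

/-- In the SFT cover of a transitive subshift, any two states are joined by a path whose length
is at most the number of states. -/
theorem exists_short_connection {A : Type*} [Finite A] [TopologicalSpace A]
    {X : Set (ℤ → A)} (hX : IsSubshift X) (htrans : LangTransitive X) {n : ℕ} {e f : List A}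
    (he : e.length = n) (hf : f.length = n)
    (heY : inLang (sftCover X n) e) (hfY : inLang (sftCover X n) f) :
    ∃ t p : List A,
      t.length ≤ Nat.card {w : List A // w.length = n ∧ inLang (sftCover X n) w} ∧
      e ++ t = p ++ f ∧ inLang (sftCover X n) (e ++ t) := by
  classical
  have hex : ∃ m, ∃ t p : List A, t.length = m ∧ e ++ t = p ++ f ∧
      inLang (sftCover X n) (e ++ t) := by
    obtain ⟨w, hw⟩ := htrans e f (inLang_of_inLang_sftCover heY he.le)
      (inLang_of_inLang_sftCover hfY hf.le)
    exact ⟨_, w ++ f, e ++ w, rfl, by simp, by simpa using hX.inLang_sftCover hw⟩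
  obtain ⟨t, p, ht, htp, htY⟩ := Nat.find_spec hex
  refine ⟨t, p, ?_, htp, htY⟩
  by_contra! hlt
  have := finite_length_and (inLang (sftCover X n)) n
  have := Fintype.ofFinite {w : List A // w.length = n ∧ inLang (sftCover X n) w}
  let win : Fin (t.length + 1) → {w : List A // w.length = n ∧ inLang (sftCover X n) w} :=
    fun i => ⟨((e ++ t).drop i).take n, by
      have := i.2
      simp only [List.length_take, List.length_drop, List.length_append]; omega,
      inLang_sftCover_of_infix htY
        ((List.take_prefix _ _).isInfix.trans (List.drop_suffix _ _).isInfix)⟩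
  obtain ⟨i, j, hij, hwin⟩ := Fintype.exists_ne_map_eq_of_card_lt win (by
    rw [Fintype.card_fin, ← Nat.card_eq_fintype_card]; omega)
  wlog hlt' : i < j generalizing i j
  · exact this j i hij.symm hwin.symm (lt_of_le_of_ne (not_lt.1 hlt') hij.symm)
  have hij' : (i : ℕ) < j := hlt'
  have hj := j.2
  have hw : ((e ++ t).drop i).take n = ((e ++ t).drop j).take n := congrArg Subtype.val hwin
  have htake : (e ++ t).take (i + n) = e ++ t.take i := by
    rw [List.take_append, List.take_of_length_le (by omega)]
    congr 2; omega
  have hdrop : (e ++ t).drop (j + n) = t.drop j := by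
    rw [List.drop_append, List.drop_of_length_le (by omega), List.nil_append]
    congr 1; omega
  have hsplit1 : (e ++ t).take (i + n) = (e ++ t).take i ++ ((e ++ t).drop i).take n :=
    List.take_add
  have hsplit2 : (e ++ t).drop j = ((e ++ t).drop j).take n ++ (e ++ t).drop (j + n) := by
    rw [← List.drop_drop, List.take_append_drop]
  have hglue := inLang_sftCover_glue (X := X) (p := (e ++ t).take i)
    (e := ((e ++ t).drop j).take n) (q := (e ++ t).drop (j + n)) (n := n) (win j).2.1
    (by rw [← hw, ← hsplit1]; exact inLang_sftCover_of_infix htY (List.take_prefix _ _).isInfix)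
    (by rw [← hsplit2]; exact inLang_sftCover_of_infix htY (List.drop_suffix _ _).isInfix)
  have hnew : (e ++ t).take i ++ ((e ++ t).drop j).take n ++ (e ++ t).drop (j + n) =
      e ++ (t.take i ++ t.drop j) := by
    rw [← hw, ← hsplit1, htake, hdrop, List.append_assoc]
  have hnew2 : (e ++ t).take i ++ ((e ++ t).drop j).take n ++ (e ++ t).drop (j + n) =
      ((e ++ t).take i ++ p.drop j) ++ f := by
    rw [List.append_assoc, ← hsplit2, htp, List.drop_append]
    have : (j : ℕ) - p.length = 0 := by
      have := congrArg List.length htp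
      simp only [List.length_append] at this
      omega
    simp [this]
  refine Nat.find_min hex (m := (t.take i ++ t.drop j).length) ?_
    ⟨t.take i ++ t.drop j, _, rfl, hnew ▸ hnew2, hnew ▸ hglue⟩
  simp only [List.length_append, List.length_take, List.length_drop]
  omega

/-- The generating function of the admissible right extensions of a word, evaluated at `μ⁻¹`. -/
noncomputable def extendWeight {A : Type*} [Fintype A] (p : List A → ℝ) (μ : ℝ) (v : List A) : ℝ :=
  ∑' m : ℕ, (μ ^ m)⁻¹ * extendSum^[m] p v

section ExtendWeight

variable {A : Type*} [Fintype A] {p : List A → ℝ} {μ : ℝ}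

theorem extendWeight_nonneg (hp : ∀ v, 0 ≤ p v) (hμ : 0 < μ) (v : List A) :
    0 ≤ extendWeight p μ v :=
  tsum_nonneg fun m => mul_nonneg (by positivity) (extendSum_iterate_nonneg hp m v)

theorem le_extendWeight (hp : ∀ v, 0 ≤ p v) (hμ : 0 < μ) {v : List A}
    (hs : Summable fun m : ℕ => (μ ^ m)⁻¹ * extendSum^[m] p v) : p v ≤ extendWeight p μ v := by
  simpa [extendWeight] using hs.le_tsum 0 fun m _ =>
    mul_nonneg (by positivity) (extendSum_iterate_nonneg hp m v)

theorem extendSum_extendWeight_le (hp : ∀ v, 0 ≤ p v) (hμ : 0 < μ)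
    (hs : ∀ v, Summable fun m : ℕ => (μ ^ m)⁻¹ * extendSum^[m] p v) (v : List A) :
    extendSum (extendWeight p μ) v ≤ μ * extendWeight p μ v := by
  have h1 : extendSum (extendWeight p μ) v =
      ∑' m : ℕ, μ * ((μ ^ (m + 1))⁻¹ * extendSum^[m + 1] p v) := by
    rw [extendSum]
    simp only [extendWeight]
    rw [← Summable.tsum_finsetSum fun c _ => hs (v ++ [c])]
    refine tsum_congr fun m => ?_
    rw [extendSum_iterate_succ, ← Finset.mul_sum, pow_succ]
    field_simp
  rw [h1, tsum_mul_left]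
  gcongr
  rw [extendWeight, (hs v).tsum_eq_zero_add]
  simpa using hp v

theorem extendWeight_mono_at {v v' : List A}
    (hs : ∀ v, Summable fun m : ℕ => (μ ^ m)⁻¹ * extendSum^[m] p v) (hμ : 0 < μ)
    (h : ∀ u, p (v ++ u) ≤ p (v' ++ u)) : extendWeight p μ v ≤ extendWeight p μ v' :=
  (hs v).tsum_le_tsum (fun m => mul_le_mul_of_nonneg_left
    (extendSum_iterate_mono_at m fun u _ => h u) (by positivity)) (hs v')

end ExtendWeight

theorem exists_le_mul_pow_of_le {b : ℕ → ℝ} {ρ : ℝ} {ℓ N : ℕ} (hρ : 0 < ρ) (hℓ : 0 < ℓ)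
    (h : ∀ m, N ≤ m → b (m + ℓ) ≤ ρ ^ ℓ * b m) : ∃ C : ℝ, 0 < C ∧ ∀ m, b m ≤ C * ρ ^ m := by
  have hnn : ∀ i, 0 ≤ |b i| / ρ ^ i := fun i => by positivity
  refine ⟨1 + ∑ i ∈ Finset.range (N + ℓ), |b i| / ρ ^ i,
    add_pos_of_pos_of_nonneg one_pos (Finset.sum_nonneg fun i _ => hnn i), fun m => ?_⟩
  induction m using Nat.strong_induction_on with
  | _ m ih =>
    by_cases hm : m < N + ℓ
    · rw [← div_le_iff₀ (by positivity)]
      have h1 := Finset.single_le_sum (f := fun i => |b i| / ρ ^ i) (fun i _ => hnn i)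
        (Finset.mem_range.2 hm)
      have h2 : b m / ρ ^ m ≤ |b m| / ρ ^ m := by gcongr; exact le_abs_self _
      linarith
    · obtain ⟨i, rfl⟩ := Nat.exists_eq_add_of_le' (show ℓ ≤ m by omega)
      calc b (i + ℓ) ≤ ρ ^ ℓ * b i := h i (by omega)
        _ ≤ ρ ^ ℓ * (_ * ρ ^ i) := by gcongr; exact ih i (by omega)
        _ = _ := by ring

theorem wordGrowth_nonneg {A : Type*} (Z : Set (ℤ → A)) (m : ℕ) :
    0 ≤ Real.log (Nat.card {w : List A // w.length = m ∧ inLang Z w}) / m :=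
  div_nonneg (Real.log_natCast_nonneg _) (Nat.cast_nonneg _)

theorem isCoboundedUnder_wordGrowth {A : Type*} (Z : Set (ℤ → A)) :
    IsCoboundedUnder (· ≤ ·) atTop fun m : ℕ =>
      Real.log (Nat.card {w : List A // w.length = m ∧ inLang Z w}) / m :=
  isCoboundedUnder_le_of_le atTop (wordGrowth_nonneg Z)

section Entropy

variable {A : Type*} [Fintype A]

theorem card_words_le (P : List A → Prop) (m : ℕ) :
    (Nat.card {w : List A // w.length = m ∧ P w} : ℝ) ≤ (Fintype.card A : ℝ) ^ m := by
  classical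
  have h := card_extensions_eq P m []
  simp only [List.nil_append] at h
  rw [h]
  refine (extendSum_iterate_mono_at (ψ := fun _ => 1) (v' := []) m fun u _ => ?_).trans
    ((extendSum_iterate_le_pow (Nat.cast_nonneg (Fintype.card A)) (fun v => ?_) m []).trans_eq
      (mul_one _))
  · split_ifs <;> norm_num
  · simp [extendSum]

theorem card_words_pos {Z : Set (ℤ → A)} (hZ : Z.Nonempty) (m : ℕ) :
    0 < Nat.card {w : List A // w.length = m ∧ inLang Z w} := by
  have := finite_length_and (inLang Z) m
  obtain ⟨x, hx⟩ := hZ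
  exact Nat.card_pos_iff.2 ⟨⟨⟨List.ofFn fun j : Fin m => x j, by simp, x, hx,
    fun j => by simp⟩⟩, this⟩

theorem wordGrowth_le {Z : Set (ℤ → A)} (hZ : Z.Nonempty) (m : ℕ) :
    Real.log (Nat.card {w : List A // w.length = m ∧ inLang Z w}) / m ≤
      Real.log (Fintype.card A) := by
  refine div_le_of_le_mul₀ (Nat.cast_nonneg _) (Real.log_natCast_nonneg _) ?_
  rw [mul_comm, ← Real.log_pow]
  exact Real.log_le_log (mod_cast card_words_pos hZ m) (card_words_le _ m)

theorem isBoundedUnder_wordGrowth {Z : Set (ℤ → A)} (hZ : Z.Nonempty) :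
    IsBoundedUnder (· ≤ ·) atTop fun m : ℕ =>
      Real.log (Nat.card {w : List A // w.length = m ∧ inLang Z w}) / m :=
  isBoundedUnder_of ⟨_, wordGrowth_le hZ⟩

theorem subshiftEntropy_nonneg {Z : Set (ℤ → A)} (hZ : Z.Nonempty) : 0 ≤ subshiftEntropy Z :=
  le_limsup_of_le (isBoundedUnder_wordGrowth hZ) fun _ hb =>
    let ⟨m, hm⟩ := hb.exists
    (wordGrowth_nonneg Z m).trans hm

theorem subshiftEntropy_le_log_card {Z : Set (ℤ → A)} (hZ : Z.Nonempty) :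
    subshiftEntropy Z ≤ Real.log (Fintype.card A) :=
  limsup_le_of_le (isCoboundedUnder_wordGrowth Z) (Eventually.of_forall (wordGrowth_le hZ))

theorem subshiftEntropy_le_log {Z : Set (ℤ → A)} (hZ : Z.Nonempty) {C ρ : ℝ} (hC : 0 < C)
    (hρ : 0 < ρ)
    (h : ∀ m, (Nat.card {w : List A // w.length = m ∧ inLang Z w} : ℝ) ≤ C * ρ ^ m) :
    subshiftEntropy Z ≤ Real.log ρ := by
  refine le_of_forall_pos_le_add fun ε hε =>
    limsup_le_of_le (isCoboundedUnder_wordGrowth Z) ?_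
  have hlim : Tendsto (fun m : ℕ => Real.log C / m) atTop (𝓝 0) :=
    tendsto_const_div_atTop_nhds_zero_nat _
  filter_upwards [hlim.eventually_lt_const hε, eventually_gt_atTop 0] with m hm hm0
  have hm0' : (0 : ℝ) < m := mod_cast hm0
  have hlog := Real.log_le_log (mod_cast card_words_pos hZ m) (h m)
  rw [Real.log_mul hC.ne' (by positivity), Real.log_pow] at hlog
  rw [div_lt_iff₀ hm0'] at hm
  rw [div_le_iff₀ hm0']
  linarith

theorem eventually_card_words_le {Z : Set (ℤ → A)} (hZ : Z.Nonempty) {η : ℝ}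
    (h : subshiftEntropy Z < η) :
    ∀ᶠ m : ℕ in atTop,
      (Nat.card {w : List A // w.length = m ∧ inLang Z w} : ℝ) ≤ Real.exp η ^ m := by
  filter_upwards [eventually_lt_of_limsup_lt h (isBoundedUnder_wordGrowth hZ),
    eventually_gt_atTop 0] with m hm hm0
  have hm0' : (0 : ℝ) < m := mod_cast hm0
  rw [div_lt_iff₀ hm0', mul_comm] at hm
  rw [← Real.exp_nat_mul]
  exact (Real.log_le_iff_le_exp (mod_cast card_words_pos hZ m)).1 hm.le

end Entropy

open Classical in
theorem summable_extendSum_iterate {A : Type*} [Fintype A] {X : Set (ℤ → A)} {n : ℕ} {μ : ℝ}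
    (hY : (sftCover X n).Nonempty) (hμ : 0 < μ) (h : subshiftEntropy (sftCover X n) < Real.log μ)
    (v : List A) :
    Summable fun m : ℕ => (μ ^ m)⁻¹ *
      extendSum^[m] (fun u => if inLang (sftCover X n) u then (1 : ℝ) else 0) v := by
  obtain ⟨η, hη, hημ⟩ := exists_between h
  have hlt : Real.exp η / μ < 1 := by
    rw [div_lt_one hμ]
    exact (Real.lt_log_iff_exp_lt hμ).1 hημ
  refine (summable_geometric_of_lt_one (by positivity) hlt).of_norm_bounded_eventually_nat ?_
  filter_upwards [eventually_card_words_le hY hη] with m hm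
  have hnn := extendSum_iterate_nonneg
    (φ := fun u => if inLang (sftCover X n) u then (1 : ℝ) else 0)
    (fun u => by split_ifs <;> norm_num) m v
  rw [Real.norm_of_nonneg (by positivity), div_pow, div_eq_inv_mul]
  gcongr
  refine le_trans ?_ hm
  have hc := card_extensions_eq (inLang (sftCover X n)) m []
  simp only [List.nil_append] at hc
  rw [hc]
  refine extendSum_iterate_mono_at m fun u _ => ?_
  by_cases hu : inLang (sftCover X n) (v ++ u)
  · rw [List.nil_append, if_pos hu,
      if_pos (inLang_sftCover_of_infix hu (List.suffix_append _ _).isInfix)]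
  · rw [if_neg hu]
    split_ifs <;> norm_num

/-- A path from the state `e` of prescribed length that runs through the forbidden word `w` and
then returns to `e` quickly. -/
theorem exists_detour {A : Type*} [Finite A] [TopologicalSpace A]
    {X : Set (ℤ → A)} (hX : IsSubshift X) (htrans : LangTransitive X) {n k s : ℕ}
    (hs : s = Nat.card {w : List A // w.length = n ∧ inLang (sftCover X n) w})
    {w e : List A} (hw : inLang (sftCover X n) w) (hnw : n ≤ w.length) (hwk : w.length ≤ n + k)
    (he : e.length = n) (heY : inLang (sftCover X n) e) :
    ∃ u t p : List A, u.length = s + k ∧ t.length ≤ s ∧ w <:+: e ++ u ∧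
      e ++ u ++ t = p ++ e ∧ inLang (sftCover X n) (e ++ u ++ t) := by
  have hw1 : inLang (sftCover X n) (w.take n) :=
    inLang_sftCover_of_infix hw (List.take_prefix _ _).isInfix
  have hl1 : (w.take n).length = n := by simp [hnw]
  obtain ⟨t₁, p₁, ht₁, htp₁, h₁⟩ := exists_short_connection hX htrans he hl1 heY hw1
  rw [← hs] at ht₁
  have h₂ : inLang (sftCover X n) (e ++ t₁ ++ w.drop n) := by
    rw [htp₁]
    exact inLang_sftCover_glue hl1 (htp₁ ▸ h₁) (by rwa [List.take_append_drop])
  obtain ⟨u', hu', h₃⟩ := exists_inLang_sftCover_append h₂ (s + k - (t₁.length + (w.length - n)))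
  obtain ⟨u, hu⟩ : ∃ u, u = t₁ ++ w.drop n ++ u' := ⟨_, rfl⟩
  have hul : u.length = s + k := by
    simp only [hu, List.length_append, List.length_drop, hu']
    omega
  have heu : e ++ u = e ++ t₁ ++ w.drop n ++ u' := by simp [hu]
  have hf : ((e ++ u).drop (s + k)).length = n := by
    simp only [List.length_drop, List.length_append]; omega
  obtain ⟨t, p, ht, htp, h₄⟩ := exists_short_connection hX htrans hf he
    (inLang_sftCover_of_infix (heu ▸ h₃) (List.drop_suffix _ _).isInfix) heY
  have hsplit := List.take_append_drop (s + k) (e ++ u)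
  refine ⟨u, t, (e ++ u).take (s + k) ++ p, hul, hs ▸ ht, ?_, ?_, ?_⟩
  · refine ⟨p₁, u', ?_⟩
    rw [heu, htp₁, List.append_assoc p₁ (w.take n), List.take_append_drop]
  · rw [List.append_assoc _ p e, ← htp, ← List.append_assoc, hsplit]
  · have := inLang_sftCover_glue hf (hsplit.symm ▸ heu ▸ h₃) h₄
    rwa [hsplit] at this

open Classical in
theorem entropy_gap_of_lt_log {A : Type*} [Fintype A] [TopologicalSpace A]
    {X : Set (ℤ → A)} (hX : IsSubshift X) (htrans : LangTransitive X) {n k s : ℕ} (hk : 1 ≤ k)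
    (hs : s = Nat.card {w : List A // w.length = n ∧ inLang (sftCover X n) w})
    {w : List A} (hw : inLang (sftCover X n) w) (hnw : n ≤ w.length) (hwk : w.length ≤ n + k)
    {Z : Set (ℤ → A)} (hZ : Z.Nonempty) (hZY : Z ⊆ sftCover X n)
    (havoid : ∀ v, inLang Z v → ¬ w <:+: v)
    {μ : ℝ} (hμ : 1 < μ) (h : subshiftEntropy (sftCover X n) < Real.log μ) :
    (μ ^ (2 * s + k))⁻¹ ≤ (s + k) * (Real.log μ - subshiftEntropy Z) := by
  have hμ0 : 0 < μ := one_pos.trans hμ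
  set Y := sftCover X n
  let p : List A → ℝ := fun u => if inLang Y u then 1 else 0
  have hp : ∀ v, 0 ≤ p v := fun v => by simp only [p]; split_ifs <;> norm_num
  have hsum := summable_extendSum_iterate (hZ.mono hZY) hμ0 h
  let r := extendWeight p μ
  have hr0 : ∀ v, 0 ≤ r v := extendWeight_nonneg hp hμ0
  have hTr : ∀ m v, extendSum^[m] r v ≤ μ ^ m * r v :=
    extendSum_iterate_le_pow hμ0.le (extendSum_extendWeight_le hp hμ0 hsum)
  let R : List A → ℝ := fun u => if inLang Y u ∧ ¬ w <:+: u then r u else 0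
  have hrR : ∀ v, 0 ≤ r v - R v := fun v => by
    simp only [R]; split_ifs <;> simp [hr0]
  set ℓ := s + k with hℓ
  have hstep : ∀ v : List A, n ≤ v.length →
      extendSum^[ℓ] R v ≤ (μ ^ ℓ - (μ ^ s)⁻¹) * R v := by
    intro v hv
    by_cases hvY : inLang Y v ∧ ¬ w <:+: v
    · have hRv : R v = r v := if_pos hvY
      obtain ⟨q, e, rfl, he⟩ : ∃ q e, q ++ e = v ∧ e.length = n :=
        ⟨v.take (v.length - n), v.drop (v.length - n), List.take_append_drop _ _, by
          simp only [List.length_drop]; omega⟩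
      have heY : inLang Y e := inLang_sftCover_of_infix hvY.1 (List.suffix_append _ _).isInfix
      obtain ⟨u, t, p', hu, ht, hwu, hret, hadm⟩ :=
        exists_detour hX htrans hs hw hnw hwk he heY
      have hfull : inLang Y (q ++ e ++ u ++ t) := by
        have := inLang_sftCover_glue (q := u ++ t) he hvY.1 (by simpa using hadm)
        simpa using this
      have hreturn : r (q ++ e) ≤ r (q ++ e ++ u ++ t) := by
        refine extendWeight_mono_at hsum hμ0 fun z => ?_
        by_cases hz : inLang Y (q ++ e ++ z)
        · have h1 : inLang Y (e ++ z) :=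
            inLang_sftCover_of_infix hz ⟨q, [], by simp⟩
          have heq : q ++ e ++ u ++ t = (q ++ p') ++ e := by
            have := congrArg (q ++ ·) hret
            simpa using this
          have h2 : inLang Y (q ++ e ++ u ++ t ++ z) := by
            rw [heq] at hfull ⊢
            exact inLang_sftCover_glue he hfull h1
          simp only [p, if_pos hz, if_pos h2, le_refl]
        · simp only [p, if_neg hz]
          split_ifs <;> norm_num
      have hback : r (q ++ e) ≤ μ ^ s * r (q ++ e ++ u) :=
        calc r (q ++ e) ≤ r (q ++ e ++ u ++ t) := hreturn
          _ ≤ extendSum^[t.length] r (q ++ e ++ u) := le_extendSum_iterate hr0 _ _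
          _ ≤ μ ^ t.length * r (q ++ e ++ u) := hTr _ _
          _ ≤ μ ^ s * r (q ++ e ++ u) := by
            gcongr
            · exact hr0 _
            · exact hμ.le
      have hRu : R (q ++ e ++ u) = 0 := if_neg fun hc => hc.2 (by
        rw [List.append_assoc]; exact hwu.trans (List.suffix_append _ _).isInfix)
      have hlost := le_extendSum_iterate hrR (q ++ e) u
      rw [extendSum_iterate_sub, hRu, sub_zero, hu] at hlost
      rw [hRv, sub_mul]
      have h1 := hTr ℓ (q ++ e)
      have h2 : (μ ^ s)⁻¹ * r (q ++ e) ≤ r (q ++ e ++ u) := by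
        rw [inv_mul_le_iff₀ (by positivity)]
        exact hback
      linarith
    · have hRv : R v = 0 := if_neg hvY
      rw [hRv, mul_zero, ← extendSum_iterate_zero ℓ v]
      refine extendSum_iterate_mono_at ℓ fun u _ => (if_neg fun hc => hvY ⟨?_, ?_⟩).le
      · exact inLang_sftCover_of_infix hc.1 (List.prefix_append _ _).isInfix
      · exact fun hwv => hc.2 (hwv.trans (List.prefix_append _ _).isInfix)
  have hℓ0 : 0 < ℓ := by omega
  have hκ : 0 < μ ^ ℓ - (μ ^ s)⁻¹ := by
    have h1 : 1 < μ ^ ℓ := one_lt_pow₀ hμ hℓ0.ne'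
    have h2 : (μ ^ s)⁻¹ ≤ 1 := inv_le_one_of_one_le₀ (one_le_pow₀ hμ.le)
    linarith
  obtain ⟨ρ, hρ, hρκ⟩ : ∃ ρ : ℝ, 0 < ρ ∧ ρ ^ ℓ = μ ^ ℓ - (μ ^ s)⁻¹ :=
    ⟨_, Real.rpow_pos_of_pos hκ _, Real.rpow_inv_natCast_pow hκ.le hℓ0.ne'⟩
  obtain ⟨C, hC, hCR⟩ := exists_le_mul_pow_of_le (b := fun m => extendSum^[m] R []) (N := n)
    hρ hℓ0 fun m hm => by
      rw [Function.iterate_add_apply, ← extendSum_iterate_const_mul, hρκ]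
      exact extendSum_iterate_mono_at m fun u hu => hstep _ (by simpa [hu] using hm)
  have hent : subshiftEntropy Z ≤ Real.log ρ := by
    refine subshiftEntropy_le_log hZ hC hρ fun m => le_trans ?_ (hCR m)
    have hc := card_extensions_eq (inLang Z) m []
    simp only [List.nil_append] at hc
    rw [hc]
    refine extendSum_iterate_mono_at m fun u _ => ?_
    by_cases hu : inLang Z ([] ++ u)
    · have huY : inLang Y ([] ++ u) := let ⟨x, hx, ho⟩ := hu; ⟨x, hZY hx, ho⟩
      rw [if_pos hu, show R ([] ++ u) = r ([] ++ u) from if_pos ⟨huY, havoid _ hu⟩]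
      have := le_extendWeight hp hμ0 (hsum ([] ++ u))
      rwa [show p ([] ++ u) = 1 from if_pos huY] at this
    · rw [if_neg hu]
      simp only [R]
      split_ifs
      exacts [hr0 _, le_rfl]
  have hlog : (ℓ : ℝ) * Real.log ρ ≤ ℓ * Real.log μ - (μ ^ (2 * s + k))⁻¹ := by
    have hfac : ρ ^ ℓ = μ ^ ℓ * (1 - (μ ^ (2 * s + k))⁻¹) := by
      have hexp : μ ^ (2 * s + k) = μ ^ ℓ * μ ^ s := by
        rw [← pow_add]
        congr 1
        omega
      rw [hρκ, hexp]
      field_simp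
    have hpos : 0 < 1 - (μ ^ (2 * s + k))⁻¹ := by
      have := hfac ▸ pow_pos hρ ℓ
      exact pos_of_mul_pos_right this (by positivity)
    rw [← Real.log_pow, hfac, Real.log_mul (by positivity) hpos.ne', Real.log_pow]
    have := Real.log_le_sub_one_of_pos hpos
    linarith
  have hℓ' : (ℓ : ℝ) = s + k := by simp [hℓ]
  rw [← hℓ']
  have : (ℓ : ℝ) * subshiftEntropy Z ≤ ℓ * Real.log ρ := by gcongr
  linarith

theorem entropy_drop_sft_cover {A : Type*} [Fintype A]
    [TopologicalSpace A] [DiscreteTopology A]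
    (X : Set (ℤ → A)) (hX : IsSubshift X) (htrans : LangTransitive X)
    (hinf : X.Infinite) (n k : ℕ) (hk : 1 ≤ k)
    (hstrict : sftCover X (n + k - 1) ⊂ sftCover X n)
    (s : ℕ) (hs : s = Nat.card { w : List A // w.length = n ∧ inLang (sftCover X n) w }) :
    subshiftEntropy (sftCover X n) - subshiftEntropy (sftCover X (n + k - 1)) >
      Real.log 2 * (s : ℝ)⁻¹ *
        Real.exp (-(3 * (3 * (s : ℝ) + 4 * (k : ℝ))) * Real.log (Fintype.card A)) := by
  have hY : (sftCover X n).Nonempty := hX.1.mono (hX.subset_sftCover n)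
  have hZ : (sftCover X (n + k - 1)).Nonempty := hX.1.mono (hX.subset_sftCover _)
  have hcard : 2 ≤ Fintype.card A := by
    by_contra! hlt
    have := Fintype.card_le_one_iff_subsingleton.1 (Nat.le_of_lt_succ hlt)
    exact hinf (Set.toFinite X)
  have hs1 : 1 ≤ s := hs ▸ card_words_pos hY n
  obtain ⟨y, hyY, hyZ⟩ := Set.exists_of_ssubset hstrict
  obtain ⟨i, w, hwl, hocc, hwX⟩ : ∃ i w, w.length ≤ n + k - 1 ∧ occursAt y i w ∧ ¬ inLang X w := by
    simpa [sftCover] using hyZ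
  have hw : inLang (sftCover X n) w := inLang_sftCover_iff.2 ⟨y, hyY, i, hocc⟩
  have hnw : n ≤ w.length := by
    by_contra! hlt
    exact hwX (inLang_of_inLang_sftCover hw hlt.le)
  have havoid : ∀ v, inLang (sftCover X (n + k - 1)) v → ¬ w <:+: v := fun v hv hwv =>
    hwX (inLang_of_inLang_sftCover (inLang_sftCover_of_infix hv hwv) hwl)
  set hh := subshiftEntropy (sftCover X n)
  set h' := subshiftEntropy (sftCover X (n + k - 1))
  set a : ℝ := ((Fintype.card A : ℕ) : ℝ)
  have ha : (2 : ℝ) ≤ a := Nat.ofNat_le_cast.2 hcard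
  have hloga : 0 < Real.log a := Real.log_pos (by linarith)
  have hh0 : 0 ≤ hh := subshiftEntropy_nonneg hY
  have hha : hh ≤ Real.log a := subshiftEntropy_le_log_card hY
  have hsk : (0 : ℝ) < s + k := by positivity
  have hgap : ((a ^ 2) ^ (2 * s + k))⁻¹ / (s + k) ≤ hh - h' := by
    refine le_of_forall_pos_le_add fun δ hδ => ?_
    let δ' := min δ (Real.log a)
    have hδ'0 : 0 < δ' := lt_min hδ hloga
    have h1 := entropy_gap_of_lt_log hX htrans hk hs hw hnw (hwl.trans (Nat.sub_le _ _)) hZ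
      hstrict.subset havoid (μ := Real.exp (hh + δ')) (Real.one_lt_exp_iff.2 (by linarith))
      (by rw [Real.log_exp]; linarith)
    rw [Real.log_exp] at h1
    have hμa : Real.exp (hh + δ') ≤ a ^ 2 := by
      rw [← Real.le_log_iff_exp_le (by positivity), Real.log_pow]
      have := min_le_right δ (Real.log a)
      push_cast
      linarith
    have h2 : ((a ^ 2) ^ (2 * s + k))⁻¹ ≤ (Real.exp (hh + δ') ^ (2 * s + k))⁻¹ := by gcongr
    rw [div_le_iff₀ hsk]
    calc _ ≤ (s + k) * (hh + δ' - h') := h2.trans h1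
      _ ≤ (s + k) * (hh + δ - h') := by gcongr; exact min_le_left _ _
      _ = _ := by ring
  refine lt_of_lt_of_le ?_ hgap
  have hexp : Real.exp (-(3 * (3 * (s : ℝ) + 4 * (k : ℝ))) * Real.log a) =
      (a ^ (9 * s + 12 * k))⁻¹ := by
    rw [← Real.exp_log (show 0 < (a ^ (9 * s + 12 * k))⁻¹ by positivity), Real.log_inv,
      Real.log_pow]
    push_cast
    ring_nf
  have hs1' : (1 : ℝ) ≤ s := by exact_mod_cast hs1
  have hpow : (s + k : ℝ) < a ^ (5 * s + 10 * k) :=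
    calc (s + k : ℝ) < 2 ^ (s + k) := by exact_mod_cast Nat.lt_two_pow_self
      _ ≤ a ^ (s + k) := by gcongr
      _ ≤ a ^ (5 * s + 10 * k) := pow_le_pow_right₀ (by linarith) (by omega)
  have hlog2 : Real.log 2 * (s : ℝ)⁻¹ ≤ 1 :=
    mul_le_one₀ (by linarith [Real.log_two_lt_d9]) (by positivity) (inv_le_one_of_one_le₀ hs1')
  rw [hexp]
  calc Real.log 2 * (s : ℝ)⁻¹ * (a ^ (9 * s + 12 * k))⁻¹ ≤ 1 * (a ^ (9 * s + 12 * k))⁻¹ := by gcongr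
    _ < ((a ^ 2) ^ (2 * s + k))⁻¹ / (s + k) := by
      rw [one_mul, lt_div_iff₀ hsk, ← pow_mul,
        show 9 * s + 12 * k = 2 * (2 * s + k) + (5 * s + 10 * k) by ring, pow_add, mul_inv,
        mul_assoc]
      refine mul_lt_of_lt_one_right (by positivity) ?_
      rwa [inv_mul_lt_iff₀ (by positivity), mul_one]
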